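/- Let S ⊆ ℝⁿ be a convex set and let each objective f_i : ℝⁿ → ℝ, i = 1, …, I, be convex on S. If x* ∈ S is weakly Pareto optimal for (f_1, …, f_I) on S, then there exist weights w_i ≥ 0, not all zero, such that x* minimizes the weighted sum x ↦ ∑_{i=1}^{I} w_i · f_i(x) over S. -/

import Mathlib

/-- Converse of the Weighted Sum Method for convex problems: every weakly
Pareto optimal point of a convex multi-objective problem minimizes some
nonnegative, not-all-zero weighted sum of the objectives. -/
theorem weakPareto_convex_exists_weights
    (n I : ℕ) (S : Set (Fin n → ℝ)) (hS : Convex ℝ S)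
    (f : Fin I → (Fin n → ℝ) → ℝ) (hf : ∀ i, ConvexOn ℝ S (f i))
    (xstar : Fin n → ℝ) (hxstar : xstar ∈ S)
    (hweak : ¬ ∃ x ∈ S, ∀ i, f i x < f i xstar) :
    ∃ w : Fin I → ℝ, (∀ i, 0 ≤ w i) ∧ (∃ j, w j ≠ 0) ∧
      ∀ x ∈ S, ∑ i, w i * f i xstar ≤ ∑ i, w i * f i x := by
  classical
  obtain ⟨g, u, hs, ht⟩ := geometric_hahn_banach_open
    (s := {y : Fin I → ℝ | ∀ i, y i < f i xstar})
    (t := {y : Fin I → ℝ | ∃ x ∈ S, ∀ i, f i x ≤ y i}) (by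
      intro y hy z hz a b ha hb hab i
      have h := (convex_Iio (𝕜 := ℝ) (f i xstar)) (hy i) (hz i) ha hb hab
      simpa using h) (by
      rw [Set.ofPred_forall]
      exact isOpen_iInter_of_finite fun i =>
        isOpen_lt (continuous_apply i) continuous_const) (by
      rintro y ⟨x, hx, hxy⟩ z ⟨x', hx', hxz⟩ a b ha hb hab
      refine ⟨a • x + b • x', hS hx hx' ha hb hab, fun i => ?_⟩
      have h := (hf i).2 hx hx' ha hb hab
      have h1 := mul_le_mul_of_nonneg_left (hxy i) ha
      have h2 := mul_le_mul_of_nonneg_left (hxz i) hb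
      simp only [smul_eq_mul] at h
      simp only [Pi.add_apply, Pi.smul_apply, smul_eq_mul]
      linarith) (by
      rw [Set.disjoint_left]
      rintro y hy ⟨x, hx, hxy⟩
      exact hweak ⟨x, hx, fun i => (hxy i).trans_lt (hy i)⟩)
  have hg : ∀ y : Fin I → ℝ, g y = ∑ i, g (Pi.single i 1) * y i := by
    intro y
    conv_lhs => rw [pi_eq_sum_univ' y]
    rw [map_sum]
    refine Finset.sum_congr rfl fun i _ => ?_
    rw [map_smul, smul_eq_mul, mul_comm]
  set F : Fin I → ℝ := fun i => f i xstar with hF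
  have hFt : u ≤ g F := ht F ⟨xstar, hxstar, fun i => le_rfl⟩
  have key : ∀ ε : ℝ, 0 < ε → g F - ε * g (fun _ => 1) < u := by
    intro ε hε
    have h := hs (F - ε • (fun _ => (1 : ℝ))) (fun i => by simp [hF, hε])
    rwa [map_sub, map_smul, smul_eq_mul] at h
  have h1 : 0 < g (fun _ => 1) := by
    have := key 1 one_pos
    linarith
  have hFu : g F ≤ u := by
    by_contra! hlt
    have h := key ((g F - u) / g (fun _ => 1)) (div_pos (sub_pos.2 hlt) h1)
    rw [div_mul_cancel₀ _ h1.ne'] at h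
    linarith
  refine ⟨fun i => g (Pi.single i 1), fun i => ?_, ?_, fun x hx => ?_⟩
  · have h := ht (F + Pi.single i 1) ⟨xstar, hxstar, fun j => by
      have : (0 : ℝ) ≤ (Pi.single i 1 : Fin I → ℝ) j := by
        rw [Pi.single_apply]; split_ifs <;> norm_num
      simp only [Pi.add_apply, hF]
      linarith⟩
    rw [map_add] at h
    linarith
  · by_contra! h0
    rw [hg] at h1
    simp [h0] at h1
  · have h := ht (fun i => f i x) ⟨x, hx, fun i => le_rfl⟩
    have h2 := hFu.trans h
    rw [hg F, hg (fun i => f i x)] at h2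
    exact h2
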